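/- arXiv:2406.02621 — 6 statements merged into one kernel-verified Lean document; each statement's English description precedes it below -/
import Mathlib

section
/- Let b0, b, d, w be real numbers with 1 + w > 0, and let H0, H, D, W : [r0, ∞) → ℝ be functions satisfying, as r → ∞: H0(r) = 2/r + b0/r² + O(r⁻³), H(r) = 2/r + b/r² + O(r⁻³), D(r) = d/r + O(r⁻²), and W(r) = w + O(r⁻¹). Define, for all sufficiently large r, ρ(r) = ( sqrt( H0(r)² + D(r)²/(1 + W(r)) ) − sqrt( H(r)² + D(r)²/(1 + W(r)) ) ) / sqrt(1 + W(r)). Then ρ(r) = 2(b0 − b) / ( sqrt(4(1+w) + d²) · r² ) + O(r⁻³) as r → ∞. -/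
/-- `BigO g k r1` means `g r = O(r^k)` as `r → ∞`:
there exist `C > 0` and `r2 ≥ r1` such that `|g r| ≤ C * r ^ k` for all `r ≥ r2`. -/
def BigO (g : ℝ → ℝ) (k : ℤ) (r1 : ℝ) : Prop :=
  ∃ C > (0 : ℝ), ∃ r2 ≥ r1, ∀ r ≥ r2, |g r| ≤ C * r ^ k

open Filter Topology Asymptotics

lemma bigO_iff (g : ℝ → ℝ) (k : ℤ) (r1 : ℝ) :
    BigO g k r1 ↔ g =O[atTop] (fun r : ℝ => r ^ k) := by
  constructor
  · rintro ⟨C, hC, r2, h2, h⟩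
    refine IsBigO.of_bound C ?_
    filter_upwards [eventually_ge_atTop r2] with r hr
    refine (h r hr).trans ?_
    exact mul_le_mul_of_nonneg_left (le_abs_self _) hC.le
  · intro h
    obtain ⟨C, hC, h⟩ := h.exists_pos
    obtain ⟨a, ha⟩ := eventually_atTop.1 h.bound
    refine ⟨C, hC, max (max a r1) 1, (le_max_right _ _).trans (le_max_left _ _), ?_⟩
    intro r hr
    have h1 : a ≤ r := ((le_max_left _ _).trans (le_max_left _ _)).trans hr
    have h3 : 1 ≤ r := (le_max_right _ _).trans hr
    have := ha r h1
    have h4 : (0:ℝ) ≤ r ^ k := by positivity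
    rwa [Real.norm_eq_abs, Real.norm_eq_abs, abs_of_nonneg h4] at this

def PExp (f : ℝ → ℝ) (c : ℝ) : Prop := (fun r => f r - c) =O[atTop] (fun r : ℝ => r⁻¹)

lemma PExp.tendsto {f : ℝ → ℝ} {c : ℝ} (h : PExp f c) : Tendsto f atTop (𝓝 c) := by
  have := h.trans_tendsto tendsto_inv_atTop_zero
  simpa using this.add_const c

lemma PExp.comp {f F : ℝ → ℝ} {c : ℝ} (h : PExp f c) (hF : DifferentiableAt ℝ F c) :
    PExp (fun r => F (f r)) (F c) :=
  (hF.isBigO_sub.comp_tendsto h.tendsto).trans h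

lemma PExp.add {f g : ℝ → ℝ} {c e : ℝ} (h : PExp f c) (h' : PExp g e) :
    PExp (fun r => f r + g r) (c + e) := by
  refine (IsBigO.add h h').congr_left ?_
  intro r; ring

lemma PExp.const (c : ℝ) : PExp (fun _ => c) c := by
  unfold PExp; simpa using isBigO_zero _ _

lemma PExp.mul {f g : ℝ → ℝ} {c e : ℝ} (h : PExp f c) (h' : PExp g e) :
    PExp (fun r => f r * g r) (c * e) := by
  have h1 : (fun r => (f r - c) * g r) =O[atTop] (fun r : ℝ => r⁻¹) := by
    simpa using IsBigO.mul h (h'.tendsto.isBigO_one ℝ)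
  have h2 : (fun r => c * (g r - e)) =O[atTop] (fun r : ℝ => r⁻¹) := IsBigO.const_mul_left h' c
  refine (h1.add h2).congr_left ?_
  intro r; ring

lemma PExp.congr {f g : ℝ → ℝ} {c e : ℝ} (h : PExp f c) (hfg : ∀ᶠ r in atTop, f r = g r)
    (hc : c = e) : PExp g e := by
  subst hc
  refine IsBigO.congr' h ?_ EventuallyEq.rfl
  filter_upwards [hfg] with r hr
  rw [hr]

lemma PExp.rinv : PExp (fun r => r⁻¹) 0 := by
  unfold PExp; simpa using isBigO_refl _ _

lemma PExp.of_H {H : ℝ → ℝ} {b : ℝ}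
    (h : (fun r => H r - (2 / r + b / r ^ 2)) =O[atTop] (fun r : ℝ => r ^ (-3 : ℤ))) :
    PExp (fun r => r * (r * H r - 2)) b := by
  have := (isBigO_refl (fun r : ℝ => r ^ 2) atTop).mul h
  refine this.congr' ?_ ?_
  · filter_upwards [eventually_gt_atTop 0] with r hr
    field_simp
    ring
  · filter_upwards [eventually_gt_atTop 0] with r hr
    rw [zpow_neg]
    field_simp

lemma PExp.of_H' {H : ℝ → ℝ} {b : ℝ} (h : PExp (fun r => r * (r * H r - 2)) b) :
    PExp (fun r => r * H r) 2 := by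
  refine ((PExp.rinv.mul h).add (PExp.const 2)).congr ?_ (by ring)
  filter_upwards [eventually_gt_atTop 0] with r hr
  field_simp
  ring

lemma rho_alg {r x y D W : ℝ} (hr : 0 < r) (hW : 0 < 1 + W) (hx : 0 < r * x) (hy : 0 < r * y) :
    (r * (r * x - 2) + (-1) * (r * (r * y - 2))) * (r * x + r * y) *
      (√((r * x) * (r * x) * (1 + W) + (r * D) * (r * D)) +
        √((r * y) * (r * y) * (1 + W) + (r * D) * (r * D)))⁻¹ =
    r ^ 2 * ((√(x ^ 2 + D ^ 2 / (1 + W)) - √(y ^ 2 + D ^ 2 / (1 + W))) / √(1 + W)) := by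
  have hx' : 0 < x := pos_of_mul_pos_right hx hr.le
  have hy' : 0 < y := pos_of_mul_pos_right hy hr.le
  have key : ∀ z : ℝ, √((r * z) * (r * z) * (1 + W) + (r * D) * (r * D)) =
      r * (√(1 + W) * √(z ^ 2 + D ^ 2 / (1 + W))) := by
    intro z
    rw [← Real.sqrt_mul hW.le]
    conv_rhs => rw [← Real.sqrt_sq hr.le]
    rw [← Real.sqrt_mul (sq_nonneg r)]
    congr 1
    field_simp
  rw [key, key]
  have hA : 0 < √(x ^ 2 + D ^ 2 / (1 + W)) := Real.sqrt_pos.2 (by positivity)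
  have hB : 0 < √(y ^ 2 + D ^ 2 / (1 + W)) := Real.sqrt_pos.2 (by positivity)
  have hA2 : √(x ^ 2 + D ^ 2 / (1 + W)) ^ 2 = x ^ 2 + D ^ 2 / (1 + W) :=
    Real.sq_sqrt (by positivity)
  have hB2 : √(y ^ 2 + D ^ 2 / (1 + W)) ^ 2 = y ^ 2 + D ^ 2 / (1 + W) :=
    Real.sq_sqrt (by positivity)
  have hS : 0 < √(1 + W) := Real.sqrt_pos.2 hW
  generalize √(x ^ 2 + D ^ 2 / (1 + W)) = A at *
  generalize √(y ^ 2 + D ^ 2 / (1 + W)) = B at *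
  generalize √(1 + W) = S at *
  have e : A ^ 2 - B ^ 2 = x ^ 2 - y ^ 2 := by rw [hA2, hB2]; ring
  have hAB : A + B ≠ 0 := by positivity
  have : r * (S * A) + r * (S * B) = r * S * (A + B) := by ring
  rw [this, ← div_eq_mul_inv, div_eq_iff (by positivity)]
  have : r ^ 2 * ((A - B) / S) * (r * S * (A + B)) = r ^ 3 * (A ^ 2 - B ^ 2) := by
    field_simp
    ring
  rw [this, e]; ring

/-- Pointwise asymptotic expansion of the Wang–Yau mass density. -/
theorem rho_expansion (b0 b d w r0 : ℝ) (hw : 1 + w > 0)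
    (H0 H D W : ℝ → ℝ)
    (hH0 : BigO (fun r => H0 r - (2 / r + b0 / r ^ 2)) (-3) r0)
    (hH : BigO (fun r => H r - (2 / r + b / r ^ 2)) (-3) r0)
    (hD : BigO (fun r => D r - d / r) (-2) r0)
    (hW : BigO (fun r => W r - w) (-1) r0) :
    BigO (fun r =>
      (Real.sqrt (H0 r ^ 2 + D r ^ 2 / (1 + W r)) -
          Real.sqrt (H r ^ 2 + D r ^ 2 / (1 + W r))) / Real.sqrt (1 + W r)
        - 2 * (b0 - b) / (Real.sqrt (4 * (1 + w) + d ^ 2) * r ^ 2)) (-3) r0 := by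
  rw [bigO_iff] at *
  have p0 := PExp.of_H hH0
  have p1 := PExp.of_H hH
  have q0 := p0.of_H'
  have q1 := p1.of_H'
  have pW : PExp W w := by simpa [PExp] using hW
  have pD : PExp (fun r => r * D r) d := by
    have := (isBigO_refl (fun r : ℝ => r) atTop).mul hD
    refine this.congr' ?_ ?_
    · filter_upwards [eventually_gt_atTop 0] with r hr
      field_simp
    · filter_upwards [eventually_gt_atTop 0] with r hr
      rw [zpow_neg]
      field_simp
  have hpos : 0 < 4 * (1 + w) + d ^ 2 := by positivity
  have hs : 0 < √(4 * (1 + w) + d ^ 2) := Real.sqrt_pos.2 hpos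
  have ec : 2 * 2 * (1 + w) + d * d = 4 * (1 + w) + d ^ 2 := by ring
  have sq : ∀ K : ℝ → ℝ, PExp (fun r => r * K r) 2 →
      PExp (fun r => √((r * K r) * (r * K r) * (1 + W r) + (r * D r) * (r * D r)))
        (√(4 * (1 + w) + d ^ 2)) := by
    intro K q
    have := ((q.mul q).mul ((PExp.const 1).add pW)).add (pD.mul pD)
    rw [ec] at this
    exact this.comp (F := Real.sqrt) (Real.hasDerivAt_sqrt hpos.ne').differentiableAt
  have inv := ((sq H0 q0).add (sq H q1)).comp (F := fun x => x⁻¹)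
    (differentiableAt_inv (by positivity))
  have tot := ((p0.add ((PExp.const (-1)).mul p1)).mul (q0.add q1)).mul inv
  have fin : PExp (fun r => r ^ 2 * ((√(H0 r ^ 2 + D r ^ 2 / (1 + W r)) -
      √(H r ^ 2 + D r ^ 2 / (1 + W r))) / √(1 + W r)))
      (2 * (b0 - b) / √(4 * (1 + w) + d ^ 2)) := by
    refine tot.congr ?_ ?_
    · filter_upwards [eventually_gt_atTop 0, q0.tendsto.eventually_const_lt (u := 0) (by norm_num),
        q1.tendsto.eventually_const_lt (u := 0) (by norm_num),
        ((PExp.const 1).add pW).tendsto.eventually_const_lt hw] with r hr hx hy hW'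
      exact rho_alg hr hW' hx hy
    · field_simp
      ring
  have := (isBigO_refl (fun r : ℝ => (r ^ 2)⁻¹) atTop).mul fin
  refine this.congr' ?_ ?_
  · filter_upwards [eventually_gt_atTop 0] with r hr
    rw [mul_sub, inv_mul_cancel_left₀ (by positivity)]
    congr 1
    field_simp
  · filter_upwards [eventually_gt_atTop 0] with r hr
    rw [zpow_neg]
    field_simp
end

section
/- Let σ denote the standard rotation-invariant surface measure on the unit sphere S² = {ω ∈ ℝ³ : |ω| = 1}, with σ(S²) = 4π, and let ωᵢ denote the i-th coordinate function on S². Let a = (a1, a2, a3) ∈ ℝ³, a0 = sqrt(1 + |a|²), let β : S² → ℝ be bounded and measurable, and let ρ, X¹, X², X³, T¹, T², T³, m : S² × [r0, ∞) → ℝ be measurable in ω and satisfy, with constants uniform in ω ∈ S²: ρ(ω, r) = β(ω)/(a0·r²) + O(r⁻³), Xⁱ(ω, r) = r·ωᵢ + O(1), Tⁱ(ω, r) = aᵢ + O(r⁻¹) for i = 1,2,3, and m(ω, r) = r² + O(r). If moreover ∫_{S²} ωᵢ·β(ω) dσ(ω) = 0 for i = 1, 2, 3, then the function r ↦ ∫_{S²}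 ρ(ω, r) · ( Σᵢ Xⁱ(ω, r)·Tⁱ(ω, r) ) · m(ω, r) dσ(ω) is bounded on [r1, ∞) for some r1 ≥ r0. -/
open MeasureTheory Metric
open scoped BigOperators

/-- The unit sphere `S² ⊂ ℝ³`. -/
abbrev S2 : Type := Metric.sphere (0 : EuclideanSpace ℝ (Fin 3)) 1

/-- The standard rotation-invariant surface measure on `S²` (total mass `4π`). -/
noncomputable abbrev sphereMeasure : Measure S2 :=
  (volume : Measure (EuclideanSpace ℝ (Fin 3))).toSphere

lemma mul_approx {u u0 v v0 c d U V e : ℝ} (he : 0 ≤ e) (he1 : e ≤ 1) (hc : 0 ≤ c) (hd : 0 ≤ d)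
    (hu : |u - u0| ≤ c * e) (hv : |v - v0| ≤ d * e) (hU : |u0| ≤ U) (hV : |v0| ≤ V) :
    |u * v - u0 * v0| ≤ (c * (V + d) + U * d) * e := by
  have h1 : |v| ≤ V + d := by
    have : |v| ≤ |v - v0| + |v0| := by simpa using abs_add_le (v - v0) v0
    nlinarith
  have hU0 : 0 ≤ U := (abs_nonneg _).trans hU
  calc |u * v - u0 * v0| = |(u - u0) * v + u0 * (v - v0)| := by ring_nf
    _ ≤ |u - u0| * |v| + |u0| * |v - v0| := by
        rw [← abs_mul, ← abs_mul]; exact abs_add_le _ _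
    _ ≤ (c * e) * (V + d) + U * (d * e) := by gcongr
    _ = _ := by ring

/-- Finiteness criterion for the conformal quasi-local energy: the potentially divergent term
`∫ ρ XⁱT⁰ᵢ μ_Σ` stays bounded as `r → ∞` when `∫ ωᵢ β dσ = 0` for `i = 1,2,3`. -/
theorem dangerous_term_bounded (r0 : ℝ) (hr0 : 0 < r0) (a : Fin 3 → ℝ)
    (β : S2 → ℝ) (hβmeas : Measurable β) (hβbd : ∃ B : ℝ, ∀ ω, |β ω| ≤ B)
    (ρ m : S2 → ℝ → ℝ) (X T : Fin 3 → S2 → ℝ → ℝ)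
    (hρmeas : ∀ r, Measurable fun ω => ρ ω r)
    (hmmeas : ∀ r, Measurable fun ω => m ω r)
    (hXmeas : ∀ i r, Measurable fun ω => X i ω r)
    (hTmeas : ∀ i r, Measurable fun ω => T i ω r)
    (hρ : ∃ C > (0 : ℝ), ∃ r2 ≥ r0, ∀ ω, ∀ r ≥ r2,
      |ρ ω r - β ω / (Real.sqrt (1 + ∑ i, a i ^ 2) * r ^ 2)| ≤ C * r ^ (-3 : ℤ))
    (hX : ∃ C > (0 : ℝ), ∃ r2 ≥ r0, ∀ i ω, ∀ r ≥ r2,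
      |X i ω r - r * (ω : EuclideanSpace ℝ (Fin 3)) i| ≤ C)
    (hT : ∃ C > (0 : ℝ), ∃ r2 ≥ r0, ∀ i ω, ∀ r ≥ r2, |T i ω r - a i| ≤ C / r)
    (hm : ∃ C > (0 : ℝ), ∃ r2 ≥ r0, ∀ ω, ∀ r ≥ r2, |m ω r - r ^ 2| ≤ C * r)
    (hβ0 : ∀ i : Fin 3,
      (∫ ω, (ω : EuclideanSpace ℝ (Fin 3)) i * β ω ∂sphereMeasure) = 0) :
    ∃ r1 ≥ r0, ∃ C : ℝ, ∀ r ≥ r1,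
      |∫ ω, ρ ω r * (∑ i, X i ω r * T i ω r) * m ω r ∂sphereMeasure| ≤ C := by
  obtain ⟨B, hB⟩ := hβbd
  obtain ⟨C1, hC1, s1, hs1, hρ⟩ := hρ
  obtain ⟨C2, hC2, s2, hs2, hX⟩ := hX
  obtain ⟨C3, hC3, s3, hs3, hT⟩ := hT
  obtain ⟨C4, hC4, s4, hs4, hm⟩ := hm
  set A := Real.sqrt (1 + ∑ i, a i ^ 2) with hA
  have hApos : 0 < A := Real.sqrt_pos.2 (by positivity)
  have hω : ∀ (ω : S2) (i : Fin 3), |(ω : EuclideanSpace ℝ (Fin 3)) i| ≤ 1 := by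
    intro ω i
    have h := PiLp.norm_apply_le (ω : EuclideanSpace ℝ (Fin 3)) i
    rw [norm_eq_of_mem_sphere] at h
    simpa using h
  have hb : ∀ ω, |β ω / A| ≤ B / A := by
    intro ω
    rw [abs_div, abs_of_pos hApos]
    gcongr
    exact hB ω
  have hmω : ∀ i : Fin 3, Measurable fun ω : S2 => (ω : EuclideanSpace ℝ (Fin 3)) i := by
    intro i
    have : Continuous fun ω : S2 => (ω : EuclideanSpace ℝ (Fin 3)) i := by fun_prop
    exact this.measurable
  have key : ∃ K : Fin 3 → ℝ, ∀ i ω r, 1 ≤ r → s1 ≤ r → s2 ≤ r → s3 ≤ r → s4 ≤ r →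
      |ρ ω r * (X i ω r * T i ω r) * m ω r
        - r * (β ω / A * ((ω : EuclideanSpace ℝ (Fin 3)) i * a i))| ≤ K i := by
    refine ⟨fun i => (C1 * (1 * |a i| + (C2 * (|a i| + C3) + 1 * C3)) +
        B / A * (C2 * (|a i| + C3) + 1 * C3)) * (1 + C4) + B / A * (1 * |a i|) * C4,
      fun i ω r h1 g1 g2 g3 g4 => ?_⟩
    · have hr : 0 < r := by linarith
      have he : 0 ≤ r⁻¹ := by positivity
      have he1 : r⁻¹ ≤ 1 := inv_le_one_of_one_le₀ h1
      have hB0 : 0 ≤ B := (abs_nonneg _).trans (hB ω)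
      have e1 : |r ^ 2 * ρ ω r - β ω / A| ≤ C1 * r⁻¹ := by
        have h := hρ ω r g1
        have : r ^ 2 * ρ ω r - β ω / A = r ^ 2 * (ρ ω r - β ω / (A * r ^ 2)) := by
          field_simp
        rw [this, abs_mul, abs_of_pos (by positivity : 0 < r ^ 2)]
        calc _ ≤ r ^ 2 * (C1 * r ^ (-3 : ℤ)) := by gcongr
          _ = _ := by
            rw [zpow_neg]
            norm_cast
            field_simp
      have e2 : |X i ω r * r⁻¹ - (ω : EuclideanSpace ℝ (Fin 3)) i| ≤ C2 * r⁻¹ := by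
        have h := hX i ω r g2
        have : X i ω r * r⁻¹ - (ω : EuclideanSpace ℝ (Fin 3)) i
            = (X i ω r - r * (ω : EuclideanSpace ℝ (Fin 3)) i) * r⁻¹ := by
          field_simp
        rw [this, abs_mul, abs_of_nonneg he]
        gcongr
      have e3 : |T i ω r - a i| ≤ C3 * r⁻¹ := by
        simpa [div_eq_mul_inv] using hT i ω r g3
      have e4 : |m ω r * (r⁻¹) ^ 2 - 1| ≤ C4 * r⁻¹ := by
        have h := hm ω r g4
        have : m ω r * (r⁻¹) ^ 2 - 1 = (m ω r - r ^ 2) * (r⁻¹) ^ 2 := by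
          field_simp
        rw [this, abs_mul, abs_of_nonneg (by positivity : 0 ≤ (r⁻¹) ^ 2)]
        calc _ ≤ C4 * r * (r⁻¹) ^ 2 := by gcongr
          _ = _ := by field_simp
      have f1 := mul_approx he he1 hC2.le hC3.le e2 e3 (hω ω i) le_rfl
      have b1 : |(ω : EuclideanSpace ℝ (Fin 3)) i * a i| ≤ 1 * |a i| := by
        rw [abs_mul]; gcongr; exact hω ω i
      have f2 := mul_approx he he1 hC1.le (by positivity) e1 f1 (hb ω) b1
      have b2 : |β ω / A * ((ω : EuclideanSpace ℝ (Fin 3)) i * a i)| ≤ B / A * (1 * |a i|) := by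
        rw [abs_mul]; gcongr; exact hb ω
      have f3 := mul_approx he he1 (by positivity) hC4.le f2 e4 b2 (abs_one.le)
      have : ρ ω r * (X i ω r * T i ω r) * m ω r
          - r * (β ω / A * ((ω : EuclideanSpace ℝ (Fin 3)) i * a i)) =
          r * (r ^ 2 * ρ ω r * (X i ω r * r⁻¹ * T i ω r) * (m ω r * (r⁻¹) ^ 2)
            - β ω / A * ((ω : EuclideanSpace ℝ (Fin 3)) i * a i) * 1) := by
        field_simp
      rw [this, abs_mul, abs_of_pos hr]
      refine (mul_le_mul_of_nonneg_left f3 hr.le).trans_eq ?_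
      rw [mul_comm, mul_assoc, inv_mul_cancel₀ hr.ne', mul_one]
  obtain ⟨K, hK⟩ := key
  refine ⟨max r0 (max 1 (max s1 (max s2 (max s3 s4)))), le_max_left _ _,
    (∑ i, K i) * (sphereMeasure.real Set.univ), fun r hr => ?_⟩
  simp only [ge_iff_le, max_le_iff] at hr
  obtain ⟨-, h1, g1, g2, g3, g4⟩ := hr
  set D : S2 → ℝ := fun ω => ∑ i, (ρ ω r * (X i ω r * T i ω r) * m ω r
        - r * (β ω / A * ((ω : EuclideanSpace ℝ (Fin 3)) i * a i))) with hD
  set G : S2 → ℝ := fun ω => ∑ i, (r / A * a i) * ((ω : EuclideanSpace ℝ (Fin 3)) i * β ω) with hG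
  have hDb : ∀ ω, ‖D ω‖ ≤ ∑ i, K i := fun ω =>
    (norm_sum_le _ _).trans (Finset.sum_le_sum fun i _ => hK i ω r h1 g1 g2 g3 g4)
  have hDm : Measurable D := by
    refine Finset.measurable_fun_sum _ fun i _ => ?_
    exact (((hρmeas r).mul ((hXmeas i r).mul (hTmeas i r))).mul (hmmeas r)).sub
      (((hβmeas.div_const A).mul ((hmω i).mul_const (a i))).const_mul r)
  have hDi : Integrable D sphereMeasure :=
    Integrable.of_bound hDm.aestronglyMeasurable _ (Filter.Eventually.of_forall hDb)
  have hGi' : ∀ i : Fin 3, Integrable (fun ω : S2 =>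
      (r / A * a i) * ((ω : EuclideanSpace ℝ (Fin 3)) i * β ω)) sphereMeasure := by
    intro i
    refine Integrable.const_mul ?_ _
    refine Integrable.of_bound ((hmω i).mul hβmeas).aestronglyMeasurable (1 * B)
      (Filter.Eventually.of_forall fun ω => ?_)
    rw [Real.norm_eq_abs, abs_mul]
    exact mul_le_mul (hω ω i) (hB ω) (abs_nonneg _) zero_le_one
  have hGi : Integrable G sphereMeasure := integrable_finsetSum _ fun i _ => hGi' i
  have hG0 : ∫ ω, G ω ∂sphereMeasure = 0 := by
    rw [hG, integral_finsetSum _ fun i _ => hGi' i]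
    refine Finset.sum_eq_zero fun i _ => ?_
    rw [integral_const_mul, hβ0 i, mul_zero]
  have hF : (fun ω => ρ ω r * (∑ i, X i ω r * T i ω r) * m ω r) = fun ω => D ω + G ω := by
    funext ω
    simp only [hD, hG, ← Finset.sum_add_distrib]
    rw [Finset.mul_sum, Finset.sum_mul]
    refine Finset.sum_congr rfl fun i _ => ?_
    ring
  rw [hF, integral_add hDi hGi, hG0, add_zero, ← Real.norm_eq_abs]
  exact norm_integral_le_of_norm_le_const (Filter.Eventually.of_forall hDb)
end

section
/- Fix t in an open interval I ⊆ ℝ and r0 > 0. Let b0, b, a0 ∈ ℝ with a0 > 0, and let H0, H, A : I × [r0, ∞) → ℝ be differentiable in t, and c0, c, A1 : I → ℝ be differentiable at t, such that at this t, as r → ∞: H0(t, r) = 2/r + b0/r² + c0(t)/r³ + O(r⁻⁴), H(t, r) = 2/r + b/r² + c(t)/r³ + O(r⁻⁴), ∂ₜH0(t, r) = c0′(t)/r³ + O(r⁻⁴), ∂ₜH(t, r) = c′(t)/r³ + O(r⁻⁴), A(t, r) = a0 + A1(t)/r + O(r⁻²), and ∂ₜA(t, r) = A1′(t)/r + O(r⁻²).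 Then A(t, r) ≠ 0 for all sufficiently large r, and the function ρ(t, r) = (H0(t, r) − H(t, r))/A(t, r) satisfies ∂ₜρ(t, r) = [ (c0′(t) − c′(t))/a0 − (b0 − b)·A1′(t)/(a0)² ] · r⁻³ + O(r⁻⁴) as r → ∞. -/
open Filter Asymptotics Topology in
theorem bigO_iff_aux (g : ℝ → ℝ) (k : ℕ) (r1 : ℝ) :
    BigO g (-(k : ℤ)) r1 ↔ g =O[atTop] (fun r : ℝ => (r⁻¹) ^ k) := by
  constructor
  · rintro ⟨C, hC, r2, hr2, h⟩
    refine IsBigO.of_bound C ?_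
    filter_upwards [eventually_ge_atTop r2, eventually_gt_atTop 0] with r hr hr'
    have := h r hr
    rw [zpow_neg, zpow_natCast] at this
    rw [Real.norm_eq_abs, Real.norm_eq_abs, abs_of_pos (a := (r⁻¹) ^ k) (by positivity), inv_pow]
    exact this
  · intro h
    obtain ⟨C, hC, h⟩ := h.exists_pos
    obtain ⟨r2, h2⟩ := eventually_atTop.1 (h.bound)
    refine ⟨C, hC, max r1 (max r2 1), le_max_left _ _, fun r hr => ?_⟩
    have h1 : r2 ≤ r := le_trans (le_trans (le_max_left _ _) (le_max_right _ _)) hr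
    have h3 : 1 ≤ r := le_trans (le_trans (le_max_right _ _) (le_max_right _ _)) hr
    have h4 : 0 < r := by linarith
    have := h2 r h1
    rw [Real.norm_eq_abs, Real.norm_eq_abs, abs_of_pos (a := (r⁻¹) ^ k) (by positivity), inv_pow] at this
    rw [zpow_neg, zpow_natCast]
    exact this

open Filter Asymptotics Topology in
theorem pow_aux {m n : ℕ} (h : n ≤ m) :
    (fun r : ℝ => (r⁻¹) ^ m) =O[atTop] (fun r : ℝ => (r⁻¹) ^ n) := by
  refine IsBigO.of_bound 1 ?_
  filter_upwards [eventually_ge_atTop (1:ℝ)] with r hr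
  have : 0 < r := by linarith
  rw [Real.norm_eq_abs, Real.norm_eq_abs, abs_of_pos (by positivity), abs_of_pos (by positivity),
    one_mul]
  exact pow_le_pow_of_le_one (by positivity) (inv_le_one_of_one_le₀ hr) h

/-- Time evolution of the mass density `ρ = (|H0| − |H|)/sqrt(1+|∇τ|²)` under the Einstein
flow: expansion of `∂ₜρ` at a fixed time `t`. -/
theorem time_derivative_of_rho (I : Set ℝ) (hI : IsOpen I) (t : ℝ) (ht : t ∈ I)
    (r0 b0 b a0 : ℝ) (hr0 : 0 < r0) (ha0 : 0 < a0)
    (H0 H A : ℝ → ℝ → ℝ) (c0 c A1 : ℝ → ℝ)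
    (hH0diff : ∀ s ∈ I, ∀ r ≥ r0, DifferentiableAt ℝ (fun u => H0 u r) s)
    (hHdiff : ∀ s ∈ I, ∀ r ≥ r0, DifferentiableAt ℝ (fun u => H u r) s)
    (hAdiff : ∀ s ∈ I, ∀ r ≥ r0, DifferentiableAt ℝ (fun u => A u r) s)
    (hc0diff : DifferentiableAt ℝ c0 t) (hcdiff : DifferentiableAt ℝ c t)
    (hA1diff : DifferentiableAt ℝ A1 t)
    (hH0 : BigO (fun r => H0 t r - (2 / r + b0 / r ^ 2 + c0 t / r ^ 3)) (-4) r0)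
    (hH : BigO (fun r => H t r - (2 / r + b / r ^ 2 + c t / r ^ 3)) (-4) r0)
    (hH0t : BigO (fun r => deriv (fun s => H0 s r) t - deriv c0 t / r ^ 3) (-4) r0)
    (hHt : BigO (fun r => deriv (fun s => H s r) t - deriv c t / r ^ 3) (-4) r0)
    (hA : BigO (fun r => A t r - (a0 + A1 t / r)) (-2) r0)
    (hAt : BigO (fun r => deriv (fun s => A s r) t - deriv A1 t / r) (-2) r0) :
    (∃ r1 ≥ r0, ∀ r ≥ r1, A t r ≠ 0) ∧
    BigO (fun r => deriv (fun s => (H0 s r - H s r) / A s r) t -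
      ((deriv c0 t - deriv c t) / a0 - (b0 - b) * deriv A1 t / a0 ^ 2) * r ^ (-3 : ℤ))
      (-4) r0 := by
  have e4 := fun g => bigO_iff_aux g 4 r0
  have e2 := fun g => bigO_iff_aux g 2 r0
  simp only [Nat.cast_ofNat] at e4 e2
  rw [e4] at hH0 hH hH0t hHt
  rw [e2] at hA hAt
  rw [e4]
  have P : ∀ (k : ℝ) {m n : ℕ}, n ≤ m →
      (fun r : ℝ => k * (r⁻¹) ^ m) =O[Filter.atTop] (fun r : ℝ => (r⁻¹) ^ n) :=
    fun k m n h => (pow_aux h).const_mul_left k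
  -- A - a0 = O(1/r)
  have hA' : (fun r => A t r - a0) =O[Filter.atTop] (fun r : ℝ => (r⁻¹) ^ 1) := by
    refine ((hA.trans (pow_aux (n := 1) (by norm_num))).add (P (A1 t) (le_refl 1))).congr_left ?_
    intro r
    ring
  have hx : Filter.Tendsto (fun r : ℝ => (r⁻¹) ^ 1) Filter.atTop (nhds 0) := by
    simpa using (tendsto_inv_atTop_zero : Filter.Tendsto (fun r : ℝ => r⁻¹) _ _)
  have hAlim : Filter.Tendsto (fun r => A t r) Filter.atTop (nhds a0) := by
    simpa using (hA'.trans_tendsto hx).add_const a0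
  have hAne : ∀ᶠ r in Filter.atTop, A t r ≠ 0 := hAlim.eventually_ne ha0.ne'
  refine ⟨?_, ?_⟩
  · obtain ⟨r1, h1⟩ := Filter.eventually_atTop.1 hAne
    exact ⟨max r0 r1, le_max_left _ _, fun r hr => h1 r (le_trans (le_max_right _ _) hr)⟩
  have hu : (fun r => (A t r)⁻¹) =O[Filter.atTop] (fun r : ℝ => (r⁻¹) ^ 0) := by
    simpa using (hAlim.inv₀ ha0.ne').isBigO_one ℝ
  have hu1 : (fun r => (A t r)⁻¹ - a0⁻¹) =O[Filter.atTop] (fun r : ℝ => (r⁻¹) ^ 1) := by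
    refine ((hA'.mul hu).const_mul_left (-a0⁻¹)).congr' ?_ ?_
    · filter_upwards [hAne] with r hr
      field_simp
      ring
    · exact Filter.Eventually.of_forall fun r => by ring
  have hu2 : (fun r => (A t r)⁻¹ + a0⁻¹) =O[Filter.atTop] (fun r : ℝ => (r⁻¹) ^ 0) := by
    refine (hu.add (P a0⁻¹ (le_refl 0))).congr_left ?_
    intro r
    ring
  have hAt' : (fun r => deriv (fun s => A s r) t) =O[Filter.atTop] (fun r : ℝ => (r⁻¹) ^ 1) := by
    refine ((hAt.trans (pow_aux (n := 1) (by norm_num))).add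
      (P (deriv A1 t) (le_refl 1))).congr_left ?_
    intro r
    ring
  have hD : (fun r => H0 t r - H t r - (b0 - b) * (r⁻¹) ^ 2) =O[Filter.atTop]
      (fun r : ℝ => (r⁻¹) ^ 3) := by
    refine (((hH0.sub hH).trans (pow_aux (n := 3) (by norm_num))).add
      (P (c0 t - c t) (le_refl 3))).congr_left ?_
    intro r
    ring
  have hDt := hH0t.sub hHt
  have T1 := hDt.mul hu
  have T2 := (P (deriv c0 t - deriv c t) (le_refl 3)).mul hu1
  have T3 := (hD.mul hAt').mul (hu.mul hu)
  have T4 := ((P (b0 - b) (le_refl 2)).mul hAt).mul (hu.mul hu)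
  have T5 := (P ((b0 - b) * deriv A1 t) (le_refl 3)).mul (hu1.mul hu2)
  simp only [← pow_add, Nat.reduceAdd] at T1 T2 T3 T4 T5
  refine ((T1.add T2).sub ((T3.add T4).add T5)).congr' ?_ Filter.EventuallyEq.rfl
  filter_upwards [hAne, Filter.eventually_ge_atTop r0] with r hr hrr
  have d := ((hH0diff t ht r hrr).hasDerivAt.sub (hHdiff t ht r hrr).hasDerivAt).div
    (hAdiff t ht r hrr).hasDerivAt hr
  have d' : deriv (fun s => (H0 s r - H s r) / A s r) t = _ := d.deriv
  have hz : r ^ (-3 : ℤ) = (r⁻¹) ^ 3 := by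
    rw [inv_pow, zpow_neg]
    norm_cast
  rw [d', hz]
  have hq : ∀ X Y : ℝ, (X * A t r - Y) / A t r ^ 2 = X * (A t r)⁻¹ - Y * ((A t r)⁻¹) ^ 2 := by
    intro X Y
    field_simp
  simp only [Pi.sub_apply]
  rw [hq]
  simp only [div_eq_mul_inv, ← inv_pow]
  ring
end

section
/- Let σ denote the standard rotation-invariant surface measure on the unit sphere S² = {ω ∈ ℝ³ : |ω| = 1}, with σ(S²) = 4π, and let ωᵢ denote the i-th coordinate function on S². Fix i ∈ {1,2,3}, t ∈ ℝ, a0 > 0, and r0 > 0. Let β : S² → ℝ be bounded measurable, λ : S² → ℝ integrable, κ ∈ ℝ, and let ρ, Xⁱ, m be real-valued functions of (t, ω, r) ∈ ℝ × S² × [r0, ∞), measurable in ω, differentiable in t, satisfying with constants uniform in ω: ρ = β(ω)/(a0·r²) + O(r⁻³), ∂ₜρ = ( λ(ω)/a0 + β(ω)·κ )/r³ + O(r⁻⁴), Xⁱ = r·ωᵢ + O(1), ∂ₜXⁱ = O(r⁻¹), m = r² + O(r), ∂ₜm = O(1) (all t-derivatives evaluated at the fixed t). If ∫_{S²} ωᵢ·β(ω)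 dσ(ω) = 0, then ∫_{S²} ∂ₜ( Xⁱ·ρ·m )(t, ω, r) dσ(ω) = (1/a0) ∫_{S²} ωᵢ·λ(ω) dσ(ω) + O(r⁻¹) as r → ∞. -/
open MeasureTheory Metric
open scoped BigOperators

lemma tdx_bound (r x b B L a0 p ρ m ρt Xt mt C1 C2 C3 C4 C5 C6 : ℝ) (hr : 1 ≤ r) (ha0 : 0 < a0)
    (hx : |x| ≤ 1) (hb : |b| ≤ B) (h1 : 0 < C1) (h2 : 0 < C2) (h3 : 0 < C3) (h4 : 0 < C4)
    (h5 : 0 < C5) (h6 : 0 < C6)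
    (hρ : |ρ - b / (a0 * r ^ 2)| ≤ C1 * r ^ (-3 : ℤ))
    (hρt : |ρt - L / r ^ 3| ≤ C2 * r ^ (-4 : ℤ))
    (hX : |p - r * x| ≤ C3) (hXt : |Xt| ≤ C4 / r) (hm : |m - r ^ 2| ≤ C5 * r) (hmt : |mt| ≤ C6) :
    |((Xt * ρ + p * ρt) * m + p * ρ * mt) - x * L| ≤
      ((C4 * (B / a0 + C1) * (1 + C5) + (1 + C3) * (B / a0 + C1) * C6
        + C3 * C2 * (1 + C5) + C2 * (1 + C5)) + (C3 * (1 + C5) + C5) * |L|) / r := by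
  have hr0 : 0 < r := by linarith
  have hB : 0 ≤ B := (abs_nonneg _).trans hb
  have hir : 1 / r ≤ 1 := by rw [div_le_one hr0]; exact hr
  obtain ⟨P, rfl⟩ : ∃ P, p = r * P := ⟨p / r, by field_simp⟩
  obtain ⟨S, rfl⟩ : ∃ S, m = r ^ 2 * S := ⟨m / r ^ 2, by field_simp⟩
  obtain ⟨Q, rfl⟩ : ∃ Q, ρt = Q / r ^ 3 := ⟨ρt * r ^ 3, by field_simp⟩
  obtain ⟨R, rfl⟩ : ∃ R, ρ = R / r ^ 2 := ⟨ρ * r ^ 2, by field_simp⟩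
  obtain ⟨Y, rfl⟩ : ∃ Y, Xt = Y / r := ⟨Xt * r, by field_simp⟩
  have eP : |P - x| ≤ C3 / r := by
    rw [le_div_iff₀ hr0, ← abs_of_pos hr0, ← abs_mul]
    rwa [show (P - x) * r = r * P - r * x by ring]
  have eS : |S - 1| ≤ C5 / r := by
    rw [show r ^ 2 * S - r ^ 2 = r ^ 2 * (S - 1) by ring, abs_mul, abs_of_pos (by positivity)] at hm
    rw [le_div_iff₀ hr0]
    have : r * (|S - 1| * r) ≤ r * C5 := by nlinarith
    exact le_of_mul_le_mul_left this hr0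
  have eQ : |Q - L| ≤ C2 / r := by
    rw [← sub_div, abs_div, abs_of_pos (show 0 < r ^ 3 by positivity), div_le_iff₀ (by positivity)] at hρt
    refine hρt.trans (le_of_eq ?_)
    rw [show (-4 : ℤ) = -((4 : ℕ) : ℤ) by norm_num, zpow_neg, zpow_natCast]
    field_simp
  have eR : |R - b / a0| ≤ C1 / r := by
    rw [show R / r ^ 2 - b / (a0 * r ^ 2) = (R - b / a0) / r ^ 2 by field_simp, abs_div,
      abs_of_pos (show 0 < r ^ 2 by positivity), div_le_iff₀ (by positivity)] at hρ
    refine hρ.trans (le_of_eq ?_)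
    rw [show (-3 : ℤ) = -((3 : ℕ) : ℤ) by norm_num, zpow_neg, zpow_natCast]
    field_simp
  have eY : |Y| ≤ C4 := by
    rw [abs_div, abs_of_pos hr0] at hXt
    exact (div_le_div_iff_of_pos_right hr0).1 hXt
  have dl : ∀ C : ℝ, 0 < C → C / r ≤ C := fun C hC => div_le_self hC.le hr
  have key : ∀ u v c d : ℝ, |u - v| ≤ c → |v| ≤ d → |u| ≤ d + c := by
    intro u v c d h h'
    have := abs_add_le (u - v) v
    rw [sub_add_cancel] at this
    linarith
  have bP : |P| ≤ 1 + C3 := key _ _ _ _ (eP.trans (dl _ h3)) hx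
  have bS : |S| ≤ 1 + C5 := key _ _ _ _ (eS.trans (dl _ h5)) (by simp)
  have bQ : |Q| ≤ |L| + C2 := key _ _ _ _ (eQ.trans (dl _ h2)) le_rfl
  have bR : |R| ≤ B / a0 + C1 := by
    refine key _ _ _ _ (eR.trans (dl _ h1)) ?_
    rw [abs_div, abs_of_pos ha0]; gcongr
  have e : ((Y / r * (R / r ^ 2) + r * P * (Q / r ^ 3)) * (r ^ 2 * S) + r * P * (R / r ^ 2) * mt) - x * L
      = (Y * R * S) / r + (P * R * mt) / r + (P - x) * Q * S + x * (Q - L) * S + x * L * (S - 1) := by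
    field_simp
    ring
  rw [e]
  have t1 : |(Y * R * S) / r| ≤ C4 * (B / a0 + C1) * (1 + C5) / r := by
    rw [abs_div, abs_of_pos hr0, abs_mul, abs_mul]; gcongr
  have t2 : |(P * R * mt) / r| ≤ (1 + C3) * (B / a0 + C1) * C6 / r := by
    rw [abs_div, abs_of_pos hr0, abs_mul, abs_mul]; gcongr
  have t3 : |(P - x) * Q * S| ≤ C3 / r * (|L| + C2) * (1 + C5) := by
    rw [abs_mul, abs_mul]; gcongr
  have t4 : |x * (Q - L) * S| ≤ 1 * (C2 / r) * (1 + C5) := by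
    rw [abs_mul, abs_mul]; gcongr
  have t5 : |x * L * (S - 1)| ≤ 1 * |L| * (C5 / r) := by
    rw [abs_mul, abs_mul]; gcongr
  refine (abs_add_le _ _).trans ((add_le_add ((abs_add_le _ _).trans (add_le_add ((abs_add_le _ _).trans
    (add_le_add ((abs_add_le _ _).trans (add_le_add t1 t2)) t3)) t4)) t5).trans (le_of_eq ?_))
  ring

/-- Time derivative of the term `∫ Xⁱ ρ μ_Σ`: if the finiteness condition
`∫ ωᵢ β dσ = 0` holds, then
`∫ ∂ₜ(Xⁱ ρ m) dσ = (1/a0) ∫ ωᵢ λ dσ + O(r⁻¹)`. -/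
theorem time_derivative_Xi_rho (i : Fin 3) (t r0 a0 : ℝ) (hr0 : 0 < r0) (ha0 : 0 < a0)
    (β : S2 → ℝ) (hβmeas : Measurable β) (hβbd : ∃ B : ℝ, ∀ ω, |β ω| ≤ B)
    (lam : S2 → ℝ) (hlam : Integrable lam sphereMeasure) (κ : ℝ)
    (ρ X m : ℝ → S2 → ℝ → ℝ) (ρt Xt mt : S2 → ℝ → ℝ)
    (hρmeas : ∀ r, Measurable fun ω => ρ t ω r)
    (hXmeas : ∀ r, Measurable fun ω => X t ω r)
    (hmmeas : ∀ r, Measurable fun ω => m t ω r)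
    (hρtmeas : ∀ r, Measurable fun ω => ρt ω r)
    (hXtmeas : ∀ r, Measurable fun ω => Xt ω r)
    (hmtmeas : ∀ r, Measurable fun ω => mt ω r)
    (hρdiff : ∀ ω, ∀ r ≥ r0, HasDerivAt (fun s => ρ s ω r) (ρt ω r) t)
    (hXdiff : ∀ ω, ∀ r ≥ r0, HasDerivAt (fun s => X s ω r) (Xt ω r) t)
    (hmdiff : ∀ ω, ∀ r ≥ r0, HasDerivAt (fun s => m s ω r) (mt ω r) t)
    (hρ : ∃ C > (0 : ℝ), ∃ r2 ≥ r0, ∀ ω, ∀ r ≥ r2,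
      |ρ t ω r - β ω / (a0 * r ^ 2)| ≤ C * r ^ (-3 : ℤ))
    (hρt : ∃ C > (0 : ℝ), ∃ r2 ≥ r0, ∀ ω, ∀ r ≥ r2,
      |ρt ω r - (lam ω / a0 + β ω * κ) / r ^ 3| ≤ C * r ^ (-4 : ℤ))
    (hX : ∃ C > (0 : ℝ), ∃ r2 ≥ r0, ∀ ω, ∀ r ≥ r2,
      |X t ω r - r * (ω : EuclideanSpace ℝ (Fin 3)) i| ≤ C)
    (hXt : ∃ C > (0 : ℝ), ∃ r2 ≥ r0, ∀ ω, ∀ r ≥ r2, |Xt ω r| ≤ C / r)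
    (hm : ∃ C > (0 : ℝ), ∃ r2 ≥ r0, ∀ ω, ∀ r ≥ r2, |m t ω r - r ^ 2| ≤ C * r)
    (hmt : ∃ C > (0 : ℝ), ∃ r2 ≥ r0, ∀ ω, ∀ r ≥ r2, |mt ω r| ≤ C)
    (hβ0 : (∫ ω, (ω : EuclideanSpace ℝ (Fin 3)) i * β ω ∂sphereMeasure) = 0) :
    ∃ C > (0 : ℝ), ∃ r1 ≥ r0, ∀ r ≥ r1,
      |(∫ ω, deriv (fun s => X s ω r * ρ s ω r * m s ω r) t ∂sphereMeasure)
        - (1 / a0) * ∫ ω, (ω : EuclideanSpace ℝ (Fin 3)) i * lam ω ∂sphereMeasure|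
        ≤ C / r := by
  obtain ⟨B, hB⟩ := hβbd
  obtain ⟨C1, h1, r1, hr1, hρ⟩ := hρ
  obtain ⟨C2, h2, r2, hr2, hρt⟩ := hρt
  obtain ⟨C3, h3, r3, hr3, hX⟩ := hX
  obtain ⟨C4, h4, r4, hr4, hXt⟩ := hXt
  obtain ⟨C5, h5, r5, hr5, hm⟩ := hm
  obtain ⟨C6, h6, r6, hr6, hmt⟩ := hmt
  have hx : ∀ ω : S2, |(ω : EuclideanSpace ℝ (Fin 3)) i| ≤ 1 := by
    intro ω
    have h := PiLp.norm_apply_le (ω : EuclideanSpace ℝ (Fin 3)) i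
    have h' : ‖(ω : EuclideanSpace ℝ (Fin 3))‖ = 1 := by simp
    rw [h', Real.norm_eq_abs] at h
    exact h
  have hxm : Measurable fun ω : S2 => (ω : EuclideanSpace ℝ (Fin 3)) i := by
    have : Continuous fun ω : S2 => (ω : EuclideanSpace ℝ (Fin 3)) i := by fun_prop
    exact this.measurable
  have hβi : Integrable β sphereMeasure :=
    Integrable.of_bound hβmeas.aestronglyMeasurable B (Filter.Eventually.of_forall hB)
  have hxβ : Integrable (fun ω : S2 => (ω : EuclideanSpace ℝ (Fin 3)) i * β ω) sphereMeasure :=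
    hβi.bdd_mul hxm.aestronglyMeasurable (c := 1) (Filter.Eventually.of_forall hx)
  have hxl : Integrable (fun ω : S2 => (ω : EuclideanSpace ℝ (Fin 3)) i * lam ω) sphereMeasure :=
    hlam.bdd_mul hxm.aestronglyMeasurable (c := 1) (Filter.Eventually.of_forall hx)
  have hL : Integrable (fun ω => lam ω / a0 + β ω * κ) sphereMeasure :=
    (hlam.div_const a0).add (hβi.mul_const κ)
  have hxL : Integrable (fun ω : S2 => (ω : EuclideanSpace ℝ (Fin 3)) i * (lam ω / a0 + β ω * κ))
      sphereMeasure :=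
    hL.bdd_mul hxm.aestronglyMeasurable (c := 1) (Filter.Eventually.of_forall hx)
  have hmain : ∫ ω : S2, (ω : EuclideanSpace ℝ (Fin 3)) i * (lam ω / a0 + β ω * κ) ∂sphereMeasure
      = (1 / a0) * ∫ ω : S2, (ω : EuclideanSpace ℝ (Fin 3)) i * lam ω ∂sphereMeasure := by
    have e : ∀ ω : S2, (ω : EuclideanSpace ℝ (Fin 3)) i * (lam ω / a0 + β ω * κ)
        = (1 / a0) * ((ω : EuclideanSpace ℝ (Fin 3)) i * lam ω)
          + κ * ((ω : EuclideanSpace ℝ (Fin 3)) i * β ω) := by intro ω; ring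
    simp_rw [e]
    rw [integral_add (hxl.const_mul _) (hxβ.const_mul _), integral_const_mul, integral_const_mul,
      hβ0, mul_zero, add_zero]
  obtain ⟨K0, hK0⟩ : ∃ K0, K0 = C4 * (B / a0 + C1) * (1 + C5) + (1 + C3) * (B / a0 + C1) * C6
        + C3 * C2 * (1 + C5) + C2 * (1 + C5) := ⟨_, rfl⟩
  obtain ⟨K1, hK1⟩ : ∃ K1, K1 = C3 * (1 + C5) + C5 := ⟨_, rfl⟩
  obtain ⟨G, hG⟩ : ∃ G : S2 → ℝ, G = fun ω => K0 + K1 * |lam ω / a0 + β ω * κ| := ⟨_, rfl⟩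
  have hGi : Integrable G sphereMeasure := by
    rw [hG]; exact (integrable_const K0).add (hL.abs.const_mul K1)
  refine ⟨|∫ ω, G ω ∂sphereMeasure| + 1, by positivity,
    max r0 (max 1 (max r1 (max r2 (max r3 (max r4 (max r5 r6)))))), le_max_left _ _, ?_⟩
  intro r hr
  simp only [ge_iff_le, max_le_iff] at hr
  obtain ⟨g0, g, g1, g2, g3, g4, g5, g6⟩ := hr
  have hrpos : 0 < r := by linarith
  have hd : ∀ ω, deriv (fun s => X s ω r * ρ s ω r * m s ω r) t
      = (Xt ω r * ρ t ω r + X t ω r * ρt ω r) * m t ω r + X t ω r * ρ t ω r * mt ω r := by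
    intro ω
    exact (((hXdiff ω r g0).mul (hρdiff ω r g0)).mul (hmdiff ω r g0)).deriv
  simp_rw [hd]
  have hbd : ∀ ω : S2, ‖((Xt ω r * ρ t ω r + X t ω r * ρt ω r) * m t ω r
      + X t ω r * ρ t ω r * mt ω r)
      - (ω : EuclideanSpace ℝ (Fin 3)) i * (lam ω / a0 + β ω * κ)‖ ≤ G ω / r := by
    intro ω
    rw [Real.norm_eq_abs, hG, hK0, hK1]
    exact tdx_bound r _ (β ω) B _ a0 _ _ _ _ _ _ C1 C2 C3 C4 C5 C6 g ha0 (hx ω) (hB ω) h1 h2 h3 h4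
      h5 h6 (hρ ω r g1) (hρt ω r g2) (hX ω r g3) (hXt ω r g4) (hm ω r g5) (hmt ω r g6)
  have hDm : Measurable fun ω : S2 => (Xt ω r * ρ t ω r + X t ω r * ρt ω r) * m t ω r
      + X t ω r * ρ t ω r * mt ω r :=
    ((((hXtmeas r).mul (hρmeas r)).add ((hXmeas r).mul (hρtmeas r))).mul (hmmeas r)).add
      (((hXmeas r).mul (hρmeas r)).mul (hmtmeas r))
  have hEi : Integrable (fun ω : S2 => ((Xt ω r * ρ t ω r + X t ω r * ρt ω r) * m t ω r
      + X t ω r * ρ t ω r * mt ω r)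
      - (ω : EuclideanSpace ℝ (Fin 3)) i * (lam ω / a0 + β ω * κ)) sphereMeasure :=
    (hGi.div_const r).mono' (hDm.aestronglyMeasurable.sub hxL.aestronglyMeasurable)
      (Filter.Eventually.of_forall hbd)
  have hDi : Integrable (fun ω : S2 => (Xt ω r * ρ t ω r + X t ω r * ρt ω r) * m t ω r
      + X t ω r * ρ t ω r * mt ω r) sphereMeasure := by
    refine (hEi.add hxL).congr (Filter.Eventually.of_forall fun ω => ?_)
    simp
  rw [← hmain, ← integral_sub hDi hxL, ← Real.norm_eq_abs]
  refine (norm_integral_le_of_norm_le (hGi.div_const r) (Filter.Eventually.of_forall hbd)).trans ?_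
  rw [integral_div]
  gcongr
  linarith [le_abs_self (∫ ω, G ω ∂sphereMeasure)]
end

section
/- Let σ denote the standard rotation-invariant surface measure on the unit sphere S² = {ω ∈ ℝ³ : |ω| = 1}, with σ(S²) = 4π, and let ωᵢ denote the i-th coordinate function on S². Fix t ∈ ℝ, r0 > 0, a = (a1, a2, a3) ∈ ℝ³, a0 = sqrt(1 + |a|²). Let β : S² → ℝ be bounded measurable, λ : S² → ℝ integrable, κ, β1, β2, β3 ∈ ℝ, and let ρ, Xⁱ, Tⁱ, m (i = 1,2,3) be real-valued functions of (t, ω, r) ∈ ℝ × S² × [r0, ∞), measurable in ω, differentiable in t, satisfying with constants uniform in ω: ρ = β(ω)/(a0·r²) + O(r⁻³), ∂ₜρ = ( λ(ω)/a0 + β(ω)·κ )/r³ + O(r⁻⁴), Xⁱ = r·ωᵢ + O(1), ∂ₜXⁱ = O(r⁻¹), Tⁱ = aᵢ + O(r⁻¹), ∂ₜTⁱ = βᵢ/r + O(r⁻²), m = r² + O(r), ∂ₜm = O(1) (all t-derivatives at the fixed t). If ∫_{S²} ωᵢ·β(ω) dσ(ω) = 0 for i = 1, 2, 3, then ∫_{S²}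 ∂ₜ( ρ·(Σᵢ Xⁱ·Tⁱ)·m )(t, ω, r) dσ(ω) = (1/a0) ∫_{S²} ( Σᵢ aᵢ·ωᵢ )·λ(ω) dσ(ω) + O(r⁻¹) as r → ∞. -/
open MeasureTheory Metric
open scoped BigOperators

def ApS (w : S2 → ℝ) (F : S2 → ℝ → ℝ) (F0 : S2 → ℝ) : Prop :=
  ∃ C ≥ (0 : ℝ), ∃ R ≥ (1 : ℝ), ∀ ω, ∀ r ≥ R, |F ω r - F0 ω| ≤ C * w ω / r ∧ |F0 ω| ≤ C * w ω

lemma ApS.add {w : S2 → ℝ} (hw : ∀ ω, 0 ≤ w ω) {F G : S2 → ℝ → ℝ} {F0 G0 : S2 → ℝ}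
    (hF : ApS w F F0) (hG : ApS w G G0) :
    ApS w (fun ω r => F ω r + G ω r) (fun ω => F0 ω + G0 ω) := by
  obtain ⟨C, hC, R, hR, h⟩ := hF
  obtain ⟨C', hC', R', hR', h'⟩ := hG
  refine ⟨C + C', by positivity, max R R', le_trans hR (le_max_left _ _), fun ω r hr => ?_⟩
  obtain ⟨h1, h2⟩ := h ω r (le_trans (le_max_left _ _) hr)
  obtain ⟨h3, h4⟩ := h' ω r (le_trans (le_max_right _ _) hr)
  constructor
  · have e : F ω r + G ω r - (F0 ω + G0 ω) = (F ω r - F0 ω) + (G ω r - G0 ω) := by ring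
    rw [e]
    have e2 : (C + C') * w ω / r = C * w ω / r + C' * w ω / r := by ring
    rw [e2]
    exact (abs_add_le _ _).trans (add_le_add h1 h3)
  · rw [add_mul]
    exact (abs_add_le _ _).trans (add_le_add h2 h4)

lemma ApS.mul {w : S2 → ℝ} (hw : ∀ ω, 0 ≤ w ω) {F G : S2 → ℝ → ℝ} {F0 G0 : S2 → ℝ}
    (hF : ApS w F F0) (hG : ApS (fun _ => 1) G G0) :
    ApS w (fun ω r => F ω r * G ω r) (fun ω => F0 ω * G0 ω) := by
  obtain ⟨C, hC, R, hR, h⟩ := hF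
  obtain ⟨C', hC', R', hR', h'⟩ := hG
  refine ⟨3 * (C * C'), by positivity, max R R', le_trans hR (le_max_left _ _), fun ω r hr => ?_⟩
  obtain ⟨h1, h2⟩ := h ω r (le_trans (le_max_left _ _) hr)
  obtain ⟨h3, h4⟩ := h' ω r (le_trans (le_max_right _ _) hr)
  have hr1 : 1 ≤ r := hR.trans (le_trans (le_max_left _ _) hr)
  have hr0 : 0 < r := by linarith
  have hwω := hw ω
  simp only [mul_one] at h3 h4
  have hCr : C' / r ≤ C' := div_le_self hC' hr1
  constructor
  · have hG' : |G ω r| ≤ 2 * C' := by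
      have : G ω r = (G ω r - G0 ω) + G0 ω := by ring
      rw [this]
      refine (abs_add_le _ _).trans ?_
      linarith
    have e : F ω r * G ω r - F0 ω * G0 ω
        = (F ω r - F0 ω) * G ω r + F0 ω * (G ω r - G0 ω) := by ring
    rw [e]
    refine (abs_add_le _ _).trans ?_
    rw [abs_mul, abs_mul]
    have a1 := mul_le_mul h1 hG' (abs_nonneg _) (by positivity)
    have a2 := mul_le_mul h2 h3 (abs_nonneg _) (by positivity)
    refine (add_le_add a1 a2).trans (le_of_eq ?_)
    ring
  · rw [abs_mul]
    have a2 := mul_le_mul h2 h4 (abs_nonneg _) (by positivity)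
    have : 0 ≤ C * w ω * C' := by positivity
    nlinarith

lemma ApS.weaken {w : S2 → ℝ} (hw : ∀ ω, 1 ≤ w ω) {F : S2 → ℝ → ℝ} {F0 : S2 → ℝ}
    (hF : ApS (fun _ => 1) F F0) : ApS w F F0 := by
  obtain ⟨C, hC, R, hR, h⟩ := hF
  refine ⟨C, hC, R, hR, fun ω r hr => ?_⟩
  obtain ⟨h1, h2⟩ := h ω r hr
  have : 0 < r := by linarith
  have h5 : C * 1 ≤ C * w ω := mul_le_mul_of_nonneg_left (hw ω) hC
  exact ⟨h1.trans (by gcongr), h2.trans h5⟩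

lemma ApS.mk' {w : S2 → ℝ} (hw : ∀ ω, 0 ≤ w ω) {F : S2 → ℝ → ℝ} {F0 : S2 → ℝ} (C C' R : ℝ)
    (hC : 0 ≤ C) (h : ∀ ω, ∀ r ≥ R, 1 ≤ r → |F ω r - F0 ω| ≤ C * w ω / r)
    (h' : ∀ ω, |F0 ω| ≤ C' * w ω) : ApS w F F0 := by
  refine ⟨max C C', hC.trans (le_max_left _ _), max R 1, le_max_right _ _, fun ω r hr => ?_⟩
  have hr1 : 1 ≤ r := (le_max_right _ _).trans hr
  have hr0 : 0 < r := by linarith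
  have := hw ω
  refine ⟨(h ω r ((le_max_left _ _).trans hr) hr1).trans ?_, (h' ω).trans ?_⟩
  · gcongr
    exact le_max_left _ _
  · gcongr
    exact le_max_right _ _

/-- Multiply an error estimate by a positive scale. -/
lemma scale_err {x y c e s : ℝ} (hc : 0 < c) (h : |x - y| ≤ e) {x' y' : ℝ}
    (hx : x' = x * c) (hy : y' = y * c) (he : e * c = s) : |x' - y'| ≤ s := by
  subst hx hy he
  rw [← sub_mul, abs_mul, abs_of_pos hc]
  gcongr

/-- Time derivative of the term `∫ ρ (Σᵢ XⁱTⁱ) μ_Σ`: under the finiteness condition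
`∫ ωᵢ β dσ = 0` (i = 1,2,3), it equals `(1/a0) ∫ (Σᵢ aᵢωᵢ) λ dσ + O(r⁻¹)`. -/
theorem time_derivative_spatial_term (t r0 : ℝ) (hr0 : 0 < r0) (a : Fin 3 → ℝ)
    (β : S2 → ℝ) (hβmeas : Measurable β) (hβbd : ∃ B : ℝ, ∀ ω, |β ω| ≤ B)
    (lam : S2 → ℝ) (hlam : Integrable lam sphereMeasure) (κ : ℝ) (bet : Fin 3 → ℝ)
    (ρ m : ℝ → S2 → ℝ → ℝ) (X T : Fin 3 → ℝ → S2 → ℝ → ℝ)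
    (ρt mt : S2 → ℝ → ℝ) (Xt Tt : Fin 3 → S2 → ℝ → ℝ)
    (hρmeas : ∀ r, Measurable fun ω => ρ t ω r)
    (hmmeas : ∀ r, Measurable fun ω => m t ω r)
    (hXmeas : ∀ i r, Measurable fun ω => X i t ω r)
    (hTmeas : ∀ i r, Measurable fun ω => T i t ω r)
    (hρtmeas : ∀ r, Measurable fun ω => ρt ω r)
    (hmtmeas : ∀ r, Measurable fun ω => mt ω r)
    (hXtmeas : ∀ i r, Measurable fun ω => Xt i ω r)
    (hTtmeas : ∀ i r, Measurable fun ω => Tt i ω r)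
    (hρdiff : ∀ ω, ∀ r ≥ r0, HasDerivAt (fun s => ρ s ω r) (ρt ω r) t)
    (hmdiff : ∀ ω, ∀ r ≥ r0, HasDerivAt (fun s => m s ω r) (mt ω r) t)
    (hXdiff : ∀ i ω, ∀ r ≥ r0, HasDerivAt (fun s => X i s ω r) (Xt i ω r) t)
    (hTdiff : ∀ i ω, ∀ r ≥ r0, HasDerivAt (fun s => T i s ω r) (Tt i ω r) t)
    (hρ : ∃ C > (0 : ℝ), ∃ r2 ≥ r0, ∀ ω, ∀ r ≥ r2,
      |ρ t ω r - β ω / (Real.sqrt (1 + ∑ i, a i ^ 2) * r ^ 2)| ≤ C * r ^ (-3 : ℤ))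
    (hρt : ∃ C > (0 : ℝ), ∃ r2 ≥ r0, ∀ ω, ∀ r ≥ r2,
      |ρt ω r - (lam ω / Real.sqrt (1 + ∑ i, a i ^ 2) + β ω * κ) / r ^ 3|
        ≤ C * r ^ (-4 : ℤ))
    (hX : ∃ C > (0 : ℝ), ∃ r2 ≥ r0, ∀ i ω, ∀ r ≥ r2,
      |X i t ω r - r * (ω : EuclideanSpace ℝ (Fin 3)) i| ≤ C)
    (hXt : ∃ C > (0 : ℝ), ∃ r2 ≥ r0, ∀ i ω, ∀ r ≥ r2, |Xt i ω r| ≤ C / r)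
    (hT : ∃ C > (0 : ℝ), ∃ r2 ≥ r0, ∀ i ω, ∀ r ≥ r2, |T i t ω r - a i| ≤ C / r)
    (hTt : ∃ C > (0 : ℝ), ∃ r2 ≥ r0, ∀ i ω, ∀ r ≥ r2,
      |Tt i ω r - bet i / r| ≤ C * r ^ (-2 : ℤ))
    (hm : ∃ C > (0 : ℝ), ∃ r2 ≥ r0, ∀ ω, ∀ r ≥ r2, |m t ω r - r ^ 2| ≤ C * r)
    (hmt : ∃ C > (0 : ℝ), ∃ r2 ≥ r0, ∀ ω, ∀ r ≥ r2, |mt ω r| ≤ C)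
    (hβ0 : ∀ i : Fin 3,
      (∫ ω, (ω : EuclideanSpace ℝ (Fin 3)) i * β ω ∂sphereMeasure) = 0) :
    ∃ C > (0 : ℝ), ∃ r1 ≥ r0, ∀ r ≥ r1,
      |(∫ ω, deriv (fun s => ρ s ω r * (∑ i, X i s ω r * T i s ω r) * m s ω r) t
          ∂sphereMeasure)
        - (1 / Real.sqrt (1 + ∑ i, a i ^ 2)) *
            ∫ ω, (∑ i, a i * (ω : EuclideanSpace ℝ (Fin 3)) i) * lam ω ∂sphereMeasure|
        ≤ C / r := by
  set a0 := Real.sqrt (1 + ∑ i, a i ^ 2) with ha0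
  have ha0pos : 0 < a0 := Real.sqrt_pos.mpr (by positivity)
  have hone : ∀ ω : S2, (0 : ℝ) ≤ (fun _ : S2 => (1 : ℝ)) ω := fun _ => zero_le_one
  have hωi : ∀ (ω : S2) (i : Fin 3), |(ω : EuclideanSpace ℝ (Fin 3)) i| ≤ 1 := by
    intro ω i
    have h1 := PiLp.norm_apply_le (ω : EuclideanSpace ℝ (Fin 3)) i
    have h2 : ‖(ω : EuclideanSpace ℝ (Fin 3))‖ = 1 := by simp
    rw [h2] at h1
    simpa using h1
  obtain ⟨B, hB⟩ := hβbd
  let w : S2 → ℝ := fun ω => 1 + |lam ω|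
  have hw1 : ∀ ω, 1 ≤ w ω := fun ω => by simp [w]
  have hw0 : ∀ ω, 0 ≤ w ω := fun ω => zero_le_one.trans (hw1 ω)
  have A_ρ : ApS (fun _ => 1) (fun ω r => ρ t ω r * r ^ 2) (fun ω => β ω / a0) := by
    obtain ⟨C, hC, R, -, h⟩ := hρ
    refine ApS.mk' hone C (B / a0) R hC.le (fun ω r hr hr1 => ?_) (fun ω => ?_)
    · have hr0 : 0 < r := by linarith
      refine scale_err (c := r ^ 2) (by positivity) (h ω r hr) rfl (by field_simp) ?_
      rw [zpow_neg]; norm_cast; field_simp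
    · rw [abs_div, abs_of_pos ha0pos, mul_one]
      have := hB ω
      gcongr
  have A_ρt : ApS w (fun ω r => ρt ω r * r ^ 3) (fun ω => lam ω / a0 + β ω * κ) := by
    obtain ⟨C, hC, R, -, h⟩ := hρt
    refine ApS.mk' hw0 C (1 / a0 + |B| * |κ|) R hC.le (fun ω r hr hr1 => ?_) (fun ω => ?_)
    · have hr0 : 0 < r := by linarith
      have : |ρt ω r * r ^ 3 - (lam ω / a0 + β ω * κ)| ≤ C / r := by
        refine scale_err (c := r ^ 3) (by positivity) (h ω r hr) rfl (by field_simp) ?_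
        rw [zpow_neg]; norm_cast; field_simp
      refine this.trans ?_
      gcongr
      exact le_mul_of_one_le_right hC.le (hw1 ω)
    · refine (abs_add_le _ _).trans ?_
      rw [add_mul]
      have hBω : |β ω| ≤ |B| := (hB ω).trans (le_abs_self _)
      refine add_le_add ?_ ?_
      · rw [abs_div, abs_of_pos ha0pos, div_mul_eq_mul_div, one_mul]
        gcongr
        simp [w]
      · rw [abs_mul]
        refine le_trans ?_ (le_mul_of_one_le_right (by positivity) (hw1 ω))
        gcongr
  have A_X : ∀ i, ApS (fun _ => 1) (fun ω r => X i t ω r / r)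
      (fun ω => (ω : EuclideanSpace ℝ (Fin 3)) i) := by
    intro i
    obtain ⟨C, hC, R, -, h⟩ := hX
    refine ApS.mk' hone C 1 R hC.le (fun ω r hr hr1 => ?_) (fun ω => by simpa using hωi ω i)
    have hr0 : 0 < r := by linarith
    exact scale_err (c := r⁻¹) (by positivity) (h i ω r hr) (by ring) (by field_simp) (by ring)
  have A_Xt : ∀ i, ApS (fun _ => 1) (fun ω r => Xt i ω r) (fun _ => 0) := by
    intro i
    obtain ⟨C, hC, R, -, h⟩ := hXt
    exact ApS.mk' hone C 1 R hC.le (fun ω r hr hr1 => by simpa using h i ω r hr) (fun ω => by simp)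
  have A_T : ∀ i, ApS (fun _ => 1) (fun ω r => T i t ω r) (fun _ => a i) := by
    intro i
    obtain ⟨C, hC, R, -, h⟩ := hT
    exact ApS.mk' hone C |a i| R hC.le (fun ω r hr hr1 => by simpa using h i ω r hr)
      (fun ω => by simp)
  have A_Tt : ∀ i, ApS (fun _ => 1) (fun ω r => Tt i ω r * r) (fun _ => bet i) := by
    intro i
    obtain ⟨C, hC, R, -, h⟩ := hTt
    refine ApS.mk' hone C |bet i| R hC.le (fun ω r hr hr1 => ?_) (fun ω => by simp)
    have hr0 : 0 < r := by linarith
    refine scale_err (c := r) (by positivity) (h i ω r hr) rfl (by field_simp) ?_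
    rw [zpow_neg]; norm_cast; field_simp
  have A_m : ApS (fun _ => 1) (fun ω r => m t ω r / r ^ 2) (fun _ => 1) := by
    obtain ⟨C, hC, R, -, h⟩ := hm
    refine ApS.mk' hone C 1 R hC.le (fun ω r hr hr1 => ?_) (fun ω => by simp)
    have hr0 : 0 < r := by linarith
    exact scale_err (c := (r ^ 2)⁻¹) (by positivity) (h ω r hr) (by ring) (by field_simp)
      (by field_simp)
  have A_mt : ApS (fun _ => 1) (fun ω r => mt ω r / r) (fun _ => 0) := by
    obtain ⟨C, hC, R, -, h⟩ := hmt
    refine ApS.mk' hone C 1 R hC.le (fun ω r hr hr1 => ?_) (fun ω => by simp)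
    have hr0 : 0 < r := by linarith
    rw [sub_zero, abs_div, abs_of_pos hr0, mul_one]
    have := h ω r hr
    gcongr
  have A_XT := ((((A_X 0).mul hone (A_T 0)).add hone ((A_X 1).mul hone (A_T 1))).add hone
    ((A_X 2).mul hone (A_T 2)))
  have A_Y := fun i => ((A_Xt i).mul hone (A_T i)).add hone ((A_X i).mul hone (A_Tt i))
  have A_YY := ((A_Y 0).add hone (A_Y 1)).add hone (A_Y 2)
  have A_D := ((A_ρt.mul hw0 A_XT).mul hw0 A_m).add hw0
    ((((A_ρ.mul hone A_YY).mul hone A_m).add hone ((A_ρ.mul hone A_XT).mul hone A_mt)).weaken hw1)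
  obtain ⟨C, hC, R, hR, hD⟩ := A_D
  have hwint : Integrable w sphereMeasure := (integrable_const 1).add hlam.abs
  have hcoord : ∀ i : Fin 3, Measurable fun ω : S2 => (ω : EuclideanSpace ℝ (Fin 3)) i := by
    intro i
    fun_prop
  have hβint : ∀ i : Fin 3, Integrable
      (fun ω : S2 => (ω : EuclideanSpace ℝ (Fin 3)) i * β ω) sphereMeasure := by
    intro i
    refine (integrable_const B).mono' ((hcoord i).mul hβmeas).aestronglyMeasurable
      (Filter.Eventually.of_forall fun ω => ?_)
    rw [Real.norm_eq_abs, abs_mul]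
    have h1 := hωi ω i
    have h2 := hB ω
    nlinarith [abs_nonneg (β ω), abs_nonneg ((ω : EuclideanSpace ℝ (Fin 3)) i)]
  have hlint : Integrable
      (fun ω : S2 => (∑ i, a i * (ω : EuclideanSpace ℝ (Fin 3)) i) * lam ω) sphereMeasure := by
    refine hlam.bdd_mul (c := ∑ i, |a i|) ?_ (Filter.Eventually.of_forall fun ω => ?_)
    · exact (Finset.measurable_sum _ fun i _ => (hcoord i).const_mul _).aestronglyMeasurable
    · refine (norm_sum_le _ _).trans (Finset.sum_le_sum fun i _ => ?_)
      rw [norm_mul]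
      exact mul_le_of_le_one_right (abs_nonneg _) (hωi ω i)
  let D0 : S2 → ℝ := fun ω =>
    (1 / a0) * ((∑ i, a i * (ω : EuclideanSpace ℝ (Fin 3)) i) * lam ω) +
      ∑ i, (κ * a i + bet i / a0) * ((ω : EuclideanSpace ℝ (Fin 3)) i * β ω)
  have hsumint : Integrable (fun ω : S2 => ∑ i, (κ * a i + bet i / a0) *
      ((ω : EuclideanSpace ℝ (Fin 3)) i * β ω)) sphereMeasure :=
    integrable_finsetSum _ fun i _ => (hβint i).const_mul _
  have hD0int : Integrable D0 sphereMeasure := (hlint.const_mul _).add hsumint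
  have hD0 : ∫ ω, D0 ω ∂sphereMeasure = (1 / a0) *
      ∫ ω, (∑ i, a i * (ω : EuclideanSpace ℝ (Fin 3)) i) * lam ω ∂sphereMeasure := by
    simp only [D0]
    rw [integral_add (hlint.const_mul _) hsumint, integral_const_mul,
      integral_finsetSum _ fun i _ => (hβint i).const_mul _]
    simp only [integral_const_mul, hβ0, mul_zero, Finset.sum_const_zero, add_zero]
  have hWnn : 0 ≤ ∫ ω, w ω ∂sphereMeasure := integral_nonneg hw0
  refine ⟨C * (∫ ω, w ω ∂sphereMeasure) + 1, by positivity, max r0 R, le_max_left _ _,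
    fun r hr => ?_⟩
  have hrr0 : r ≥ r0 := (le_max_left _ _).trans hr
  have hrR : r ≥ R := (le_max_right _ _).trans hr
  have hrpos : 0 < r := by linarith
  let D : S2 → ℝ := fun ω =>
    (ρt ω r * (∑ i, X i t ω r * T i t ω r)
      + ρ t ω r * (∑ i, (Xt i ω r * T i t ω r + X i t ω r * Tt i ω r))) * m t ω r
      + ρ t ω r * (∑ i, X i t ω r * T i t ω r) * mt ω r
  have hderiv : ∀ ω, deriv (fun s => ρ s ω r * (∑ i, X i s ω r * T i s ω r) * m s ω r) t
      = D ω := by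
    intro ω
    have hs : HasDerivAt (fun s => ∑ i, X i s ω r * T i s ω r)
        (∑ i, (Xt i ω r * T i t ω r + X i t ω r * Tt i ω r)) t :=
      HasDerivAt.fun_sum fun i _ => (hXdiff i ω r hrr0).mul (hTdiff i ω r hrr0)
    exact (((hρdiff ω r hrr0).mul hs).mul (hmdiff ω r hrr0)).deriv
  have hbound : ∀ ω, |D ω - D0 ω| ≤ C * w ω / r := by
    intro ω
    convert (hD ω r hrR).1 using 2
    simp only [D, D0, Fin.sum_univ_three]
    field_simp
    ring
  have hDmeas : Measurable D := by
    have hXT : Measurable fun ω => ∑ i, X i t ω r * T i t ω r :=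
      Finset.measurable_sum _ fun i _ => (hXmeas i r).mul (hTmeas i r)
    have hY : Measurable fun ω => ∑ i, (Xt i ω r * T i t ω r + X i t ω r * Tt i ω r) :=
      Finset.measurable_sum _ fun i _ =>
        ((hXtmeas i r).mul (hTmeas i r)).add ((hXmeas i r).mul (hTtmeas i r))
    exact ((((hρtmeas r).mul hXT).add ((hρmeas r).mul hY)).mul (hmmeas r)).add
      (((hρmeas r).mul hXT).mul (hmtmeas r))
  have hbint : Integrable (fun ω => C * w ω / r) sphereMeasure :=
    (hwint.const_mul C).div_const r
  have hdiff : Integrable (fun ω => D ω - D0 ω) sphereMeasure :=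
    hbint.mono' (hDmeas.aestronglyMeasurable.sub hD0int.aestronglyMeasurable)
      (Filter.Eventually.of_forall hbound)
  have hDint : Integrable D sphereMeasure := by
    have := hdiff.add hD0int
    refine this.congr (Filter.Eventually.of_forall fun ω => ?_)
    simp
  simp only [hderiv]
  rw [← hD0, ← integral_sub hDint hD0int]
  have h1 := norm_integral_le_of_norm_le (f := fun ω => D ω - D0 ω) hbint (Filter.Eventually.of_forall hbound)
  rw [Real.norm_eq_abs] at h1
  refine h1.trans ?_
  rw [integral_div, integral_const_mul]
  gcongr
  linarith
end

section
/- Let Ŝ, S₁ be symmetric 2×2 real matrices with Ŝ positive definite, let r0 > 0, and let E : [r0, ∞) → M₂(ℝ) be a matrix-valued function with ‖E(r)‖ bounded on [r0, ∞). Set S(r) = r²·Ŝ + r·S₁ + E(r). Then det S(r) > 0 for all sufficiently large r, and sqrt( det S(r) ) = sqrt( det Ŝ )·r² + (1/2)·sqrt( det Ŝ )·tr( Ŝ⁻¹ S₁ )·r + O(1) as r → ∞. -/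
theorem aux_expansion (s t K r0 : ℝ) (D : ℝ → ℝ) (hs : 0 < s) (hK : 0 ≤ K)
    (h : ∀ r ≥ r0, 1 ≤ r → |D r - (s * r ^ 2 + (1 / 2) * s * t * r) ^ 2| ≤ K * r ^ 2) :
    (∃ r1 ≥ r0, ∀ r ≥ r1, 0 < D r) ∧
    ∃ C > (0 : ℝ), ∃ r1 ≥ r0, ∀ r ≥ r1,
      |Real.sqrt (D r) - (s * r ^ 2 + (1 / 2) * s * t * r)| ≤ C := by
  have key : ∃ r1 ≥ r0, ∀ r ≥ r1, 0 < D r ∧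
      |Real.sqrt (D r) - (s * r ^ 2 + (1 / 2) * s * t * r)| ≤ 2 * K / s + 1 := by
    refine ⟨max r0 (1 + |t| + 4 * K / s ^ 2), le_max_left _ _, fun r hr => ?_⟩
    have h0 : r0 ≤ r := le_trans (le_max_left _ _) hr
    have h1 : 1 + |t| + 4 * K / s ^ 2 ≤ r := le_trans (le_max_right _ _) hr
    have hq : 0 ≤ 4 * K / s ^ 2 := by positivity
    have ht := abs_nonneg t
    have hr1 : 1 ≤ r := by linarith
    have hrt : -t ≤ r := by linarith [neg_le_abs t]
    have hrK : 4 * K < s ^ 2 * r := by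
      have : 4 * K / s ^ 2 < r := by linarith
      rw [div_lt_iff₀ (by positivity)] at this
      linarith
    have hh := h r h0 hr1
    set P := s * r ^ 2 + (1 / 2) * s * t * r with hP
    have hP2 : s * r ^ 2 / 2 ≤ P := by
      have : 0 ≤ s * r * (r + t) := by
        apply mul_nonneg (by positivity); linarith
      rw [hP]; nlinarith
    have hPP : (s * r ^ 2 / 2) ^ 2 ≤ P ^ 2 := by
      apply pow_le_pow_left₀ (by positivity) hP2
    have hD : 0 < D r := by
      have h2 := (abs_le.1 hh).1
      have h3 : 4 * K < s ^ 2 * r ^ 2 := by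
        have : s ^ 2 * r ≤ s ^ 2 * r ^ 2 := by
          apply mul_le_mul_of_nonneg_left _ (by positivity); nlinarith
        linarith
      have h4 : 4 * K * r ^ 2 < s ^ 2 * r ^ 2 * r ^ 2 :=
        mul_lt_mul_of_pos_right h3 (by positivity)
      nlinarith
    refine ⟨hD, ?_⟩
    have hsq := Real.sq_sqrt hD.le
    have hsn := Real.sqrt_nonneg (D r)
    set q := Real.sqrt (D r)
    have hpos : 0 < s * r ^ 2 / 2 := by positivity
    have e : |q - P| * (q + P) = |D r - P ^ 2| := by
      rw [← hsq, sq_sub_sq, abs_mul, abs_of_nonneg (by linarith : 0 ≤ q + P)]; ring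
    have h5 : |q - P| * (s * r ^ 2 / 2) ≤ K * r ^ 2 := by
      have : |q - P| * (s * r ^ 2 / 2) ≤ |q - P| * (q + P) :=
        mul_le_mul_of_nonneg_left (by linarith) (abs_nonneg _)
      linarith
    have h6 : |q - P| ≤ 2 * K / s := by
      rw [le_div_iff₀ hs]
      have hr2 : 0 < r ^ 2 := by positivity
      refine le_of_mul_le_mul_right ?_ hr2
      linarith
    linarith
  obtain ⟨r1, h1, h2⟩ := key
  exact ⟨⟨r1, h1, fun r hr => (h2 r hr).1⟩, 2 * K / s + 1, by positivity, r1, h1,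
    fun r hr => (h2 r hr).2⟩

/-- Expansion of the area density `sqrt(det σ)` of the induced metric
`σ(r) = r²σ̂ + rσ¹ + O(1)` on large coordinate spheres. -/
theorem sqrt_det_expansion (Shat S1 : Matrix (Fin 2) (Fin 2) ℝ)
    (hShatSymm : Shat.IsSymm) (hS1Symm : S1.IsSymm) (hShat : Shat.PosDef)
    (r0 : ℝ) (hr0 : 0 < r0) (E : ℝ → Matrix (Fin 2) (Fin 2) ℝ)
    (hE : ∃ B : ℝ, ∀ r ≥ r0, ∀ i j, |E r i j| ≤ B) :
    (∃ r1 ≥ r0, ∀ r ≥ r1, 0 < (r ^ 2 • Shat + r • S1 + E r).det) ∧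
    ∃ C > (0 : ℝ), ∃ r1 ≥ r0, ∀ r ≥ r1,
      |Real.sqrt (r ^ 2 • Shat + r • S1 + E r).det -
        (Real.sqrt Shat.det * r ^ 2 +
          (1 / 2) * Real.sqrt Shat.det * (Shat⁻¹ * S1).trace * r)| ≤ C := by
  obtain ⟨B, hB⟩ := hE
  have hd := hShat.det_pos
  have htr : Shat.det * (Shat⁻¹ * S1).trace = Shat 1 1 * S1 0 0 - Shat 0 1 * S1 1 0
      - Shat 1 0 * S1 0 1 + Shat 0 0 * S1 1 1 := by
    have : Shat.det * (Shat⁻¹ * S1).trace = (Shat.adjugate * S1).trace := by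
      rw [Matrix.inv_def, Matrix.smul_mul, Matrix.trace_smul, smul_eq_mul,
        Ring.inverse_eq_inv', mul_inv_cancel_left₀ hd.ne']
    rw [this, Matrix.adjugate_fin_two, Matrix.trace_fin_two]
    simp [Matrix.mul_apply, Fin.sum_univ_two]
    ring
  have hss := Real.sq_sqrt hd.le
  generalize (Shat⁻¹ * S1).trace = t at *
  obtain ⟨M, hM0, hMA, hMS, hME⟩ : ∃ M : ℝ, 0 ≤ M ∧ (∀ i j, |Shat i j| ≤ M) ∧
      (∀ i j, |S1 i j| ≤ M) ∧ ∀ r ≥ r0, ∀ i j, |E r i j| ≤ M := by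
    have hs (A : Matrix (Fin 2) (Fin 2) ℝ) (i j) : |A i j| ≤ ∑ i, ∑ j, |A i j| := by
      refine le_trans ?_ (Finset.single_le_sum (f := fun i => ∑ j, |A i j|)
        (fun i _ => by positivity) (Finset.mem_univ i))
      exact Finset.single_le_sum (f := fun j => |A i j|) (fun i _ => by positivity)
        (Finset.mem_univ j)
    have p1 : 0 ≤ ∑ i, ∑ j, |Shat i j| := by positivity
    have p2 : 0 ≤ ∑ i, ∑ j, |S1 i j| := by positivity
    refine ⟨(∑ i, ∑ j, |Shat i j|) + (∑ i, ∑ j, |S1 i j|) + |B|, by positivity, ?_, ?_, ?_⟩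
    · intro i j; linarith [hs Shat i j, abs_nonneg B]
    · intro i j; linarith [hs S1 i j, abs_nonneg B]
    · intro r hr i j; linarith [hB r hr i j, le_abs_self B]
  have hm : ∀ x y : ℝ, |x| ≤ M → |y| ≤ M → |x * y| ≤ M ^ 2 := fun x y hx hy => by
    rw [abs_mul, sq]; exact mul_le_mul hx hy (abs_nonneg _) hM0
  refine aux_expansion (Real.sqrt Shat.det) t (12 * M ^ 2 + Shat.det * t ^ 2 / 4) r0
    (fun r => (r ^ 2 • Shat + r • S1 + E r).det) (Real.sqrt_pos.2 hd) (by positivity) ?_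
  intro r hr h1
  have hE := hME r hr
  have b1 := fun i j k l => abs_le.1 (hm _ _ (hMA i j) (hE k l))
  have b2 := fun i j k l => abs_le.1 (hm _ _ (hMS i j) (hE k l))
  have b3 := fun i j k l => abs_le.1 (hm _ _ (hMS i j) (hMS k l))
  have b4 := fun i j k l => abs_le.1 (hm _ _ (hE i j) (hE k l))
  have e : (r ^ 2 • Shat + r • S1 + E r).det
      - (Real.sqrt Shat.det * r ^ 2 + (1 / 2) * Real.sqrt Shat.det * t * r) ^ 2
      = r ^ 2 * (S1 0 0 * S1 1 1 - S1 0 1 * S1 1 0 + Shat 0 0 * E r 1 1 + Shat 1 1 * E r 0 0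
          - Shat 0 1 * E r 1 0 - Shat 1 0 * E r 0 1)
        + r * (S1 0 0 * E r 1 1 + S1 1 1 * E r 0 0 - S1 0 1 * E r 1 0 - S1 1 0 * E r 0 1)
        + (E r 0 0 * E r 1 1 - E r 0 1 * E r 1 0) - Shat.det * t ^ 2 / 4 * r ^ 2 := by
    have : (Real.sqrt Shat.det * r ^ 2 + (1 / 2) * Real.sqrt Shat.det * t * r) ^ 2
      = Shat.det * r ^ 4 + (Shat.det * t) * r ^ 3 + Shat.det * t ^ 2 / 4 * r ^ 2 := by
      linear_combination (r ^ 2 + 1 / 2 * t * r) ^ 2 * hss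
    rw [this, htr, Matrix.det_fin_two (r ^ 2 • Shat + r • S1 + E r)]
    have hdd := Matrix.det_fin_two Shat
    simp only [Matrix.add_apply, Matrix.smul_apply, smul_eq_mul]
    linear_combination (-r ^ 4) * hdd
  show |(r ^ 2 • Shat + r • S1 + E r).det - _| ≤ _
  rw [e]
  have hX : |S1 0 0 * S1 1 1 - S1 0 1 * S1 1 0 + Shat 0 0 * E r 1 1 + Shat 1 1 * E r 0 0
          - Shat 0 1 * E r 1 0 - Shat 1 0 * E r 0 1| ≤ 6 * M ^ 2 := by
    rw [abs_le]
    constructor <;> linarith [b3 0 0 1 1, b3 0 1 1 0, b1 0 0 1 1, b1 1 1 0 0, b1 0 1 1 0,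
      b1 1 0 0 1]
  have hY : |S1 0 0 * E r 1 1 + S1 1 1 * E r 0 0 - S1 0 1 * E r 1 0 - S1 1 0 * E r 0 1|
      ≤ 4 * M ^ 2 := by
    rw [abs_le]
    constructor <;> linarith [b2 0 0 1 1, b2 1 1 0 0, b2 0 1 1 0, b2 1 0 0 1]
  have hZ : |E r 0 0 * E r 1 1 - E r 0 1 * E r 1 0| ≤ 2 * M ^ 2 := by
    rw [abs_le]
    constructor <;> linarith [b4 0 0 1 1, b4 0 1 1 0]
  generalize S1 0 0 * S1 1 1 - S1 0 1 * S1 1 0 + Shat 0 0 * E r 1 1 + Shat 1 1 * E r 0 0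
          - Shat 0 1 * E r 1 0 - Shat 1 0 * E r 0 1 = X at *
  generalize S1 0 0 * E r 1 1 + S1 1 1 * E r 0 0 - S1 0 1 * E r 1 0 - S1 1 0 * E r 0 1 = Y at *
  generalize E r 0 0 * E r 1 1 - E r 0 1 * E r 1 0 = Z at *
  have hW : 0 ≤ Shat.det * t ^ 2 / 4 * r ^ 2 := by positivity
  have hrr : r ≤ r ^ 2 := by nlinarith
  have hX' : |r ^ 2 * X| ≤ r ^ 2 * (6 * M ^ 2) := by
    rw [abs_mul, abs_of_nonneg (by positivity : 0 ≤ r ^ 2)]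
    exact mul_le_mul_of_nonneg_left hX (by positivity)
  have hY' : |r * Y| ≤ r ^ 2 * (4 * M ^ 2) := by
    rw [abs_mul, abs_of_nonneg (by linarith : 0 ≤ r)]
    exact mul_le_mul hrr hY (abs_nonneg _) (by positivity)
  have hZ' : |Z| ≤ r ^ 2 * (2 * M ^ 2) := by
    have : 1 * (2 * M ^ 2) ≤ r ^ 2 * (2 * M ^ 2) :=
      mul_le_mul_of_nonneg_right (by linarith) (by positivity)
    linarith
  rw [abs_le] at *
  constructor <;> linarith [hX'.1, hX'.2, hY'.1, hY'.2, hZ'.1, hZ'.2]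
end
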